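/- arXiv:0909.3023 — 4 statements merged into one kernel-verified Lean document; each statement's English description precedes it below -/
import Mathlib

section
/- Let n ≥ 3, let ℓ_1,…,ℓ_{n−1} > 0 and 0 < ℓ_n⁻ < ℓ_n⁺ be generic metric data A, and assume ℓ_n⁺ − ℓ_n⁻ < [ℓ⁻], where ℓ⁻ = (ℓ_1,…,ℓ_{n−1},ℓ_n⁻). Then for every t ∈ [ℓ_n⁻, ℓ_n⁺], the length vector (ℓ_1,…,ℓ_{n−1},t) is generic; that is, for every sign vector (ε_1,…,ε_n) ∈ {±1}ⁿ one has ε_1 ℓ_1 + … + ε_{n−1} ℓ_{n−1} + ε_n t ≠ 0. -/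
open Finset
open scoped Classical

noncomputable section

/-- `dsum ℓ J = ∑_{i ∈ J} ℓ i − ∑_{i ∉ J} ℓ i`. -/
def dsum {n : ℕ} (ℓ : Fin n → ℝ) (J : Finset (Fin n)) : ℝ :=
  ∑ i ∈ J, ℓ i - ∑ i ∈ Jᶜ, ℓ i

/-- `J` is long with respect to `ℓ`. -/
def IsLong {n : ℕ} (ℓ : Fin n → ℝ) (J : Finset (Fin n)) : Prop := 0 < dsum ℓ J

/-- `J` is short with respect to `ℓ`. -/
def IsShort {n : ℕ} (ℓ : Fin n → ℝ) (J : Finset (Fin n)) : Prop := dsum ℓ J < 0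

/-- `ℓ` is generic: `s_J(ℓ) ≠ 0` for every subset `J`. -/
def Generic {n : ℕ} (ℓ : Fin n → ℝ) : Prop := ∀ J : Finset (Fin n), dsum ℓ J ≠ 0

/-- `alphaNum ℓ k` is the number of subsets `J ⊆ {1,…,n−1}` (in zero-based indexing:
subsets of `Fin n` avoiding the last index, which corresponds to the telescopic leg `n`)
of cardinality `n − k − 1` which are long with respect to `ℓ`.  The cardinality condition
is stated over `ℤ`, so that `alphaNum ℓ j = 0` for `j` outside the range `0 ≤ j ≤ n − 2`. -/
def alphaNum {n : ℕ} (ℓ : Fin n → ℝ) (k : ℤ) : ℕ :=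
  (univ.filter (fun J : Finset (Fin n) =>
    (∀ i ∈ J, (i : ℕ) + 1 < n) ∧ (J.card : ℤ) = (n : ℤ) - k - 1 ∧ IsLong ℓ J)).card

/-- `betaNum ℓp ℓm k` is the number of subsets `J ⊆ {1,…,n−2}` of cardinality `n − k − 2`
such that `J ∪ {n}` is short with respect to `ℓp` and `J ∪ {n−1}` is long with respect
to `ℓm` (zero-based: the paper's index `n` is the last index of `Fin n`, i.e. the unique
`i` with `i + 1 = n`, and the paper's `n − 1` is the unique `i` with `i + 2 = n`). -/
def betaNum {n : ℕ} (ℓp ℓm : Fin n → ℝ) (k : ℤ) : ℕ :=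
  (univ.filter (fun J : Finset (Fin n) =>
    (∀ i ∈ J, (i : ℕ) + 2 < n) ∧ (J.card : ℤ) = (n : ℤ) - k - 2 ∧
    IsShort ℓp (J ∪ univ.filter (fun i : Fin n => (i : ℕ) + 1 = n)) ∧
    IsLong ℓm (J ∪ univ.filter (fun i : Fin n => (i : ℕ) + 2 = n)))).card

/-- `gapVal ℓ` is the quantity `[ℓ]`: the minimum of `∑ εᵢ ℓᵢ` over all sign vectors
`ε ∈ {±1}ⁿ` for which this sum is nonnegative (the sums `∑ εᵢ ℓᵢ` are exactly the
numbers `dsum ℓ J`, `J ⊆ {1,…,n}`). -/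
def gapVal {n : ℕ} (ℓ : Fin n → ℝ) : ℝ :=
  sInf {x : ℝ | 0 ≤ x ∧ ∃ J : Finset (Fin n), dsum ℓ J = x}

theorem dsum_compl {n : ℕ} (ℓ : Fin n → ℝ) (J : Finset (Fin n)) :
    dsum ℓ Jᶜ = -dsum ℓ J := by
  simp [dsum]

theorem sum_sign_mul_eq_dsum {n : ℕ} (ℓ ε : Fin n → ℝ) (hε : ∀ i, ε i = 1 ∨ ε i = -1) :
    ∑ i, ε i * ℓ i = dsum ℓ (univ.filter fun i => ε i = 1) := by
  rw [dsum, ← sum_add_sum_compl (univ.filter fun i => ε i = 1), sub_eq_add_neg,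
    ← sum_neg_distrib]
  congr 1 <;> refine sum_congr rfl fun i hi => ?_
  · simp [(mem_filter.mp hi).2]
  · simp [(hε i).resolve_left (by simpa using hi)]

theorem gapVal_le_abs_dsum {n : ℕ} (ℓ : Fin n → ℝ) (J : Finset (Fin n)) :
    gapVal ℓ ≤ |dsum ℓ J| := by
  refine csInf_le ⟨0, fun x hx => hx.1⟩ ⟨abs_nonneg _, ?_⟩
  rcases abs_choice (dsum ℓ J) with h | h
  · exact ⟨J, h.symm⟩
  · exact ⟨Jᶜ, by rw [dsum_compl, h]⟩

/-- If `ℓ_n⁺ − ℓ_n⁻ < [ℓ⁻]` then every length vector `(ℓ_1,…,ℓ_{n−1},t)` with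
`t ∈ [ℓ_n⁻, ℓ_n⁺]` is generic: `∑ εᵢ ℓᵢ + ε_n t ≠ 0` for every sign vector `ε`. -/
theorem stmt_2 (n : ℕ) (hn : 3 ≤ n) (ℓm ℓp : Fin n → ℝ)
    (hpos : ∀ i : Fin n, 0 < ℓm i)
    (heq : ∀ i : Fin n, (i : ℕ) + 1 < n → ℓp i = ℓm i)
    (hlt : ℓm ⟨n - 1, by omega⟩ < ℓp ⟨n - 1, by omega⟩)
    (hgenp : Generic ℓp) (hgenm : Generic ℓm)
    (hgap : ℓp ⟨n - 1, by omega⟩ - ℓm ⟨n - 1, by omega⟩ < gapVal ℓm) :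
    ∀ t ∈ Set.Icc (ℓm ⟨n - 1, by omega⟩) (ℓp ⟨n - 1, by omega⟩),
      ∀ ε : Fin n → ℝ, (∀ i, ε i = 1 ∨ ε i = -1) →
        ∑ i : Fin n, ε i * (fun j : Fin n => if (j : ℕ) + 1 = n then t else ℓm j) i ≠ 0 := by
  intro t ht ε hε hsum
  have hsplit : ∀ i : Fin n, ε i * (if (i : ℕ) + 1 = n then t else ℓm i) =
      ε i * ℓm i + if i = ⟨n - 1, by omega⟩ then
        ε ⟨n - 1, by omega⟩ * (t - ℓm ⟨n - 1, by omega⟩) else 0 := by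
    intro i
    by_cases hi : i = ⟨n - 1, by omega⟩
    · have hlast : n - 1 + 1 = n := by omega
      subst hi
      simp only [hlast, if_true]
      ring
    · have hlast : ¬ (i : ℕ) + 1 = n := fun h => hi (Fin.ext (by simp only; omega))
      simp [hi, hlast]
  simp only [hsplit, sum_add_distrib, sum_ite_eq', mem_univ, if_true,
    sum_sign_mul_eq_dsum ℓm ε hε] at hsum
  have hgap_le := gapVal_le_abs_dsum ℓm (univ.filter fun i => ε i = 1)
  have habs : |ε ⟨n - 1, by omega⟩| = 1 := by
    rcases hε ⟨n - 1, by omega⟩ with h | h <;> simp [h]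
  rw [eq_neg_of_add_eq_zero_left hsum, abs_neg, abs_mul, habs, one_mul,
    abs_of_nonneg (sub_nonneg.mpr ht.1)] at hgap_le
  linarith [ht.2]
end
end

section
/- Let n ≥ 3 and let ℓ⁺, ℓ⁻ ∈ ℝⁿ satisfy ℓ⁺_i = ℓ⁻_i = ℓ_i > 0 for i = 1,…,n−1 and ℓ⁺_n > ℓ⁻_n > 0, and assume both ℓ⁺ and ℓ⁻ are generic. Then for every k with 0 ≤ k ≤ n−2, the difference α_k(ℓ⁺) − β_k(ℓ⁻, ℓ⁺) equals the number of subsets J ⊆ {1,…,n−1} with |J| = n−k−1 such that J is long with respect to ℓ⁺ and either n−1 ∉ J, or n−1 ∈ J and the set (J∪{n})∖{n−1} is long with respect to ℓ⁻. -/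
open Finset
open scoped Classical

/-- `α_k(ℓ⁺) − β_k(ℓ⁻, ℓ⁺)` equals the number of subsets `J ⊆ {1,…,n−1}` with
`|J| = n − k − 1` such that `J` is long with respect to `ℓ⁺` and either `n−1 ∉ J`, or
`n−1 ∈ J` and `(J ∪ {n}) ∖ {n−1}` is long with respect to `ℓ⁻` (zero-based indexing:
the paper's index `n` is the unique `i : Fin n` with `i + 1 = n`, and the paper's
`n − 1` is the unique `i` with `i + 2 = n`). -/
theorem stmt_9 (n : ℕ) (hn : 3 ≤ n) (ℓp ℓm : Fin n → ℝ)
    (hpos : ∀ i : Fin n, 0 < ℓm i)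
    (heq : ∀ i : Fin n, (i : ℕ) + 1 < n → ℓp i = ℓm i)
    (hlt : ℓm ⟨n - 1, by omega⟩ < ℓp ⟨n - 1, by omega⟩)
    (hgenp : Generic ℓp) (hgenm : Generic ℓm)
    (k : ℕ) (hk : k ≤ n - 2) :
    (alphaNum ℓp (k : ℤ) : ℤ) - (betaNum ℓm ℓp (k : ℤ) : ℤ) =
      ((univ.filter (fun J : Finset (Fin n) =>
        (∀ i ∈ J, (i : ℕ) + 1 < n) ∧ (J.card : ℤ) = (n : ℤ) - k - 1 ∧ IsLong ℓp J ∧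
        ((∀ i ∈ J, (i : ℕ) + 2 ≠ n) ∨
          ((∃ i ∈ J, (i : ℕ) + 2 = n) ∧
            IsLong ℓm ((J \ univ.filter (fun i : Fin n => (i : ℕ) + 2 = n)) ∪
              univ.filter (fun i : Fin n => (i : ℕ) + 1 = n)))))).card : ℤ) := by
  set a : Fin n := ⟨n - 2, by omega⟩ with ha
  have hA : univ.filter (fun i : Fin n => (i : ℕ) + 2 = n) = {a} := by
    ext i; simp [ha, Fin.ext_iff]; omega
  have hval : ∀ i : Fin n, (i : ℕ) + 2 = n ↔ i = a := by
    intro i; simp [ha, Fin.ext_iff]; omega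
  have hav : (a : ℕ) + 2 = n := (hval a).2 rfl
  unfold alphaNum betaNum
  simp only [hA]
  set b := univ.filter (fun i : Fin n => (i : ℕ) + 1 = n) with hb
  set p : Finset (Fin n) → Prop := fun J => (∀ i ∈ J, (i : ℕ) + 2 ≠ n) ∨
    ((∃ i ∈ J, (i : ℕ) + 2 = n) ∧ IsLong ℓm ((J \ {a}) ∪ b)) with hp
  have hsplit := card_filter_add_card_filter_not (s := univ.filter (fun J : Finset (Fin n) =>
    (∀ i ∈ J, (i : ℕ) + 1 < n) ∧ (J.card : ℤ) = (n : ℤ) - k - 1 ∧ IsLong ℓp J)) p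
  have hnot : ∀ J : Finset (Fin n), ¬ p J ↔ a ∈ J ∧ IsShort ℓm ((J \ {a}) ∪ b) := by
    intro J
    have hs : IsShort ℓm ((J \ {a}) ∪ b) ↔ ¬ IsLong ℓm ((J \ {a}) ∪ b) := by
      unfold IsShort IsLong
      rw [not_lt, le_iff_lt_or_eq]
      simp [hgenm _]
    have hall : (∀ i ∈ J, (i : ℕ) + 2 ≠ n) ↔ a ∉ J := by
      simp only [ne_eq, hval]
      exact ⟨fun h hi => h a hi rfl, fun h i hi hia => h (hia ▸ hi)⟩
    have hex : (∃ i ∈ J, (i : ℕ) + 2 = n) ↔ a ∈ J := by simp [hval]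
    simp only [hp, hs, hall, hex]
    tauto
  have hbeta : (univ.filter (fun J : Finset (Fin n) =>
      (∀ i ∈ J, (i : ℕ) + 2 < n) ∧ (J.card : ℤ) = (n : ℤ) - k - 2 ∧
      IsShort ℓm (J ∪ b) ∧ IsLong ℓp (J ∪ {a}))).card =
      ((univ.filter (fun J : Finset (Fin n) =>
        (∀ i ∈ J, (i : ℕ) + 1 < n) ∧ (J.card : ℤ) = (n : ℤ) - k - 1 ∧
          IsLong ℓp J)).filter (fun J => ¬ p J)).card := by
    refine card_nbij' (fun J => J ∪ {a}) (fun J => J \ {a}) ?_ ?_ ?_ ?_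
    · intro J hJ
      simp only [coe_filter, mem_univ, true_and, Set.mem_ofPred_eq, mem_filter, hnot] at hJ ⊢
      obtain ⟨h1, h2, h3, h4⟩ := hJ
      have haJ : a ∉ J := fun h => by have := h1 a h; omega
      have hd : (J ∪ {a}) \ {a} = J := by
        ext i; simp only [mem_sdiff, mem_union, mem_singleton]; grind
      refine ⟨⟨?_, ?_, h4⟩, by simp, by rwa [hd]⟩
      · intro i hi
        rcases mem_union.1 hi with h | h
        · have := h1 i h; omega
        · rw [mem_singleton] at h; subst h; omega
      · rw [card_union_of_disjoint (by simpa using haJ), card_singleton]; push_cast; omega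
    · intro J hJ
      simp only [coe_filter, mem_univ, true_and, Set.mem_ofPred_eq, mem_filter, hnot] at hJ ⊢
      obtain ⟨⟨h1, h2, h3⟩, h4, h5⟩ := hJ
      have hu : (J \ {a}) ∪ {a} = J := sdiff_union_of_subset (by simpa using h4)
      refine ⟨?_, ?_, h5, by rwa [hu]⟩
      · intro i hi
        rw [mem_sdiff, mem_singleton] at hi
        have := h1 i hi.1
        have := mt (hval i).1 hi.2
        omega
      · have := card_sdiff_add_card_eq_card (s := {a}) (t := J) (by simpa using h4)
        rw [card_singleton] at this
        omega
    · intro J hJ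
      simp only [coe_filter, mem_univ, true_and, Set.mem_ofPred_eq] at hJ
      have haJ : a ∉ J := fun h => by have := hJ.1 a h; omega
      ext i; simp only [mem_sdiff, mem_union, mem_singleton]; grind
    · intro J hJ
      simp only [coe_filter, mem_univ, true_and, Set.mem_ofPred_eq, mem_filter, hnot] at hJ
      exact sdiff_union_of_subset (by simpa using hJ.2.1)
  rw [hbeta, ← hsplit, filter_filter]
  simp only [and_assoc]
  push_cast
  ring
end

section
/- Let n ≥ 4 and let ℓ_1,…,ℓ_{n−1} > 0 with ℓ_1 ≤ … ≤ ℓ_{n−1} and 0 < ℓ_n⁻ < ℓ_n⁺ be generic metric data, with ℓ⁻ = (ℓ_1,…,ℓ_{n−1},ℓ_n⁻) and ℓ⁺ = (ℓ_1,…,ℓ_{n−1},ℓ_n⁺). Then the difference α_{n−3}(ℓ⁺) − β_{n−3}(ℓ⁻, ℓ⁺) is either 0 or 1, and it equals 1 if and only if either (a) 2(ℓ_{n−3} + ℓ_{n−2}) ≥ ℓ_1 + … + ℓ_{n−1} + ℓ_n⁺, or (b) both 2(ℓ_{n−2} + ℓ_{n−1}) ≥ ℓ_1 + … + ℓ_{n−1}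 + ℓ_n⁺ and 2(ℓ_{n−2} + ℓ_n⁻) ≥ ℓ_1 + … + ℓ_{n−1} + ℓ_n⁻ hold. Moreover, conditions (a) and (b) cannot hold simultaneously. -/
open Finset
open scoped Classical

theorem dsum_eq_two_mul_sub {n : ℕ} (ℓ : Fin n → ℝ) (J : Finset (Fin n)) :
    dsum ℓ J = 2 * ∑ i ∈ J, ℓ i - ∑ i, ℓ i := by
  rw [dsum, ← Finset.sum_add_sum_compl J ℓ]
  ring

theorem dsum_pair {n : ℕ} (ℓ : Fin n → ℝ) {i j : Fin n} (hij : i ≠ j) :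
    dsum ℓ {i, j} = 2 * (ℓ i + ℓ j) - ∑ i, ℓ i := by
  rw [dsum_eq_two_mul_sub, Finset.sum_pair hij]

/-- A long pair outweighs every pair disjoint from it. -/
theorem IsLong.add_lt_add_of_pair {n : ℕ} {ℓ : Fin n → ℝ} (hpos : ∀ i, 0 < ℓ i)
    {i j k l : Fin n} (hij : i ≠ j) (hkl : k ≠ l) (hik : i ≠ k) (hil : i ≠ l) (hjk : j ≠ k)
    (hjl : j ≠ l) (h : IsLong ℓ {i, j}) : ℓ k + ℓ l < ℓ i + ℓ j := by
  have hsub : ({k, l} : Finset (Fin n)) ⊆ {i, j}ᶜ := by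
    intro x hx
    simp only [mem_insert, mem_singleton, mem_compl] at hx ⊢
    rcases hx with rfl | rfl <;> simp [hik.symm, hil.symm, hjk.symm, hjl.symm]
  have hle := Finset.sum_le_sum_of_subset_of_nonneg hsub (f := ℓ) fun x _ _ => (hpos x).le
  rw [IsLong, dsum, Finset.sum_pair hij] at h
  rw [Finset.sum_pair hkl] at hle
  linarith

/-- For data increasing away from the last index `d`, a long pair `{i, j}` avoiding `d` is
`{a, b}` or contains `c`, where `a`, `b`, `c`, `d` are the last four indices in order. -/
theorem IsLong.eq_of_lt {n : ℕ} {ℓ : Fin n → ℝ} (hpos : ∀ i, 0 < ℓ i)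
    (hmono : ∀ i j : Fin n, i ≤ j → (j : ℕ) + 1 < n → ℓ i ≤ ℓ j)
    {a b c : Fin n} (ha : (a : ℕ) + 4 = n) (hb : (b : ℕ) + 3 = n) (hc : (c : ℕ) + 2 = n)
    {i j : Fin n} (hij : i < j) (hj : (j : ℕ) + 2 < n) (h : IsLong ℓ {i, j}) :
    i = a ∧ j = b := by
  have hij' : (i : ℕ) < j := hij
  by_cases hjb : j = b
  · refine ⟨?_, hjb⟩
    by_contra hia
    have h1 := h.add_lt_add_of_pair hpos (k := a) (l := c) hij.ne (by omega) hia (by omega)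
      (by omega) (by omega)
    have h2 := hmono i a (by omega) (by omega)
    have h3 := hmono j c (by omega) (by omega)
    linarith
  · have h1 := h.add_lt_add_of_pair hpos (k := b) (l := c) hij.ne (by omega) (by omega) (by omega)
      (by omega) (by omega)
    have h2 := hmono i b (by omega) (by omega)
    have h3 := hmono j c (by omega) (by omega)
    linarith

/-- The only index `i` below `c` for which `{i, c}` and `{i, d}` are long with respect to `ℓp`
and `ℓm` respectively is `b`. -/
theorem eq_of_isLong_of_isLong {n : ℕ} {ℓp ℓm : Fin n → ℝ} (hpp : ∀ i, 0 < ℓp i)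
    (hpos : ∀ i, 0 < ℓm i) (heq : ∀ i : Fin n, (i : ℕ) + 1 < n → ℓp i = ℓm i)
    (hmono : ∀ i j : Fin n, i ≤ j → (j : ℕ) + 1 < n → ℓm i ≤ ℓm j)
    {b c d i : Fin n} (hb : (b : ℕ) + 3 = n) (hc : (c : ℕ) + 2 = n) (hd : (d : ℕ) + 1 = n)
    (hlt : ℓm d < ℓp d) (hi : (i : ℕ) + 2 < n)
    (h1 : IsLong ℓp {i, c}) (h2 : IsLong ℓm {i, d}) : i = b := by
  by_contra hib
  have h3 := h1.add_lt_add_of_pair hpp (k := b) (l := d) (by omega) (by omega) hib (by omega)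
    (by omega) (by omega)
  have h4 := h2.add_lt_add_of_pair hpos (k := b) (l := c) (by omega) (by omega) hib (by omega)
    (by omega) (by omega)
  have h5 := hmono i b (by omega) (by omega)
  rw [heq b (by omega), heq i (by omega), heq c (by omega)] at h3
  linarith

/-- `{a, b}` long for `ℓp` is incompatible with `{b, d}` long for
`ℓm`. -/
theorem not_isLong_of_isLong {n : ℕ} {ℓp ℓm : Fin n → ℝ} (hpp : ∀ i, 0 < ℓp i)
    (hpos : ∀ i, 0 < ℓm i) (heq : ∀ i : Fin n, (i : ℕ) + 1 < n → ℓp i = ℓm i)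
    (hmono : ∀ i j : Fin n, i ≤ j → (j : ℕ) + 1 < n → ℓm i ≤ ℓm j)
    {a b c d : Fin n} (ha : (a : ℕ) + 4 = n) (hb : (b : ℕ) + 3 = n) (hc : (c : ℕ) + 2 = n)
    (hd : (d : ℕ) + 1 = n) (hlt : ℓm d < ℓp d)
    (h1 : IsLong ℓp {a, b}) : ¬ IsLong ℓm {b, d} := by
  intro h2
  have h3 := h1.add_lt_add_of_pair hpp (k := c) (l := d) (by omega) (by omega) (by omega)
    (by omega) (by omega) (by omega)
  have h4 := h2.add_lt_add_of_pair hpos (k := a) (l := c) (by omega) (by omega) (by omega)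
    (by omega) (by omega) (by omega)
  have h5 := hmono b c (by omega) (by omega)
  rw [heq b (by omega), heq a (by omega), heq c (by omega)] at h3
  linarith

/-- Genericity turns the weak inequality into longness of the pair. -/
theorem Generic.isLong_pair_iff {n : ℕ} {ℓ : Fin n → ℝ} (hg : Generic ℓ) {i j : Fin n}
    (hij : i ≠ j) : IsLong ℓ {i, j} ↔ 2 * (ℓ i + ℓ j) ≥ ∑ i, ℓ i := by
  have h := hg {i, j}
  rw [IsLong, dsum_pair ℓ hij] at *
  constructor
  · intro h'
    linarith
  · intro h'
    exact lt_of_le_of_ne (by linarith) h.symm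

theorem sum_filter_add_last {n : ℕ} {ℓp ℓm : Fin n → ℝ}
    (heq : ∀ i : Fin n, (i : ℕ) + 1 < n → ℓp i = ℓm i) {d : Fin n} (hd : (d : ℕ) + 1 = n) :
    (∑ i ∈ univ.filter (fun i : Fin n => (i : ℕ) + 1 < n), ℓm i) + ℓp d = ∑ i, ℓp i := by
  rw [← Finset.sum_filter_add_sum_filter_not univ (fun i : Fin n => (i : ℕ) + 1 < n) ℓp]
  congr 1
  · refine Finset.sum_congr rfl fun i hi => (heq i ?_).symm
    simpa using hi
  · have : univ.filter (fun i : Fin n => ¬ (i : ℕ) + 1 < n) = {d} := by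
      ext i
      simp only [mem_filter, mem_univ, true_and, mem_singleton]
      omega
    rw [this, Finset.sum_singleton]

theorem alphaNum_eq_card_add {n : ℕ} {ℓp ℓm : Fin n → ℝ} (hpp : ∀ i, 0 < ℓp i)
    (hpos : ∀ i, 0 < ℓm i) (heq : ∀ i : Fin n, (i : ℕ) + 1 < n → ℓp i = ℓm i)
    (hmono : ∀ i j : Fin n, i ≤ j → (j : ℕ) + 1 < n → ℓm i ≤ ℓm j)
    {a b c d : Fin n} (ha : (a : ℕ) + 4 = n) (hb : (b : ℕ) + 3 = n) (hc : (c : ℕ) + 2 = n)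
    (hd : (d : ℕ) + 1 = n) (hlt : ℓm d < ℓp d) (hgenm : Generic ℓm) :
    alphaNum ℓp ((n : ℤ) - 3) = betaNum ℓm ℓp ((n : ℤ) - 3) +
      if IsLong ℓp {a, b} ∨ (IsLong ℓp {b, c} ∧ IsLong ℓm {b, d}) then 1 else 0 := by
  have hfd : univ.filter (fun i : Fin n => (i : ℕ) + 1 = n) = {d} := by
    ext i
    simp only [mem_filter, mem_univ, true_and, mem_singleton]
    omega
  have hfc : univ.filter (fun i : Fin n => (i : ℕ) + 2 = n) = {c} := by
    ext i
    simp only [mem_filter, mem_univ, true_and, mem_singleton]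
    omega
  have hmonop : ∀ i j : Fin n, i ≤ j → (j : ℕ) + 1 < n → ℓp i ≤ ℓp j := by
    intro i j hij hj
    have hij' : (i : ℕ) ≤ j := hij
    rw [heq i (by omega), heq j hj]
    exact hmono i j hij hj
  unfold alphaNum betaNum
  rw [hfd, hfc]
  set X := univ.filter (fun J : Finset (Fin n) =>
    (∀ i ∈ J, (i : ℕ) + 1 < n) ∧ (J.card : ℤ) = (n : ℤ) - (n - 3) - 1 ∧ IsLong ℓp J) with hX
  set B := univ.filter (fun J : Finset (Fin n) =>
    (∀ i ∈ J, (i : ℕ) + 2 < n) ∧ (J.card : ℤ) = (n : ℤ) - (n - 3) - 2 ∧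
    IsShort ℓm (J ∪ {d}) ∧ IsLong ℓp (J ∪ {c})) with hB
  set T := univ.filter (fun i : Fin n =>
    (i : ℕ) + 2 < n ∧ IsShort ℓm {i, d} ∧ IsLong ℓp {i, c}) with hT
  have hBT : B = T.image fun i => {i} := by
    ext J
    simp only [hB, hT, mem_filter, mem_univ, true_and, mem_image]
    constructor
    · rintro ⟨h1, h2, h3, h4⟩
      obtain ⟨i, rfl⟩ := Finset.card_eq_one.1 (show J.card = 1 by omega)
      exact ⟨i, ⟨h1 i (by simp), h3, h4⟩, rfl⟩
    · rintro ⟨i, ⟨h1, h2, h3⟩, rfl⟩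
      exact ⟨by simpa using h1, by simp, h2, h3⟩
  have hBcard : B.card = T.card := by
    rw [hBT, Finset.card_image_of_injective _ Finset.singleton_injective]
  have hTc : (T.image fun i => ({i, c} : Finset (Fin n))).card = T.card := by
    refine Finset.card_image_of_injOn fun i hi j hj hij => ?_
    simp only [hT, coe_filter, mem_univ, true_and, Set.mem_ofPred_eq] at hi hj
    have : i ∈ ({j, c} : Finset (Fin n)) := by
      rw [← show ({i, c} : Finset (Fin n)) = {j, c} from hij]
      simp
    simp only [mem_insert, mem_singleton] at this
    omega
  have hXmem : ∀ J, J ∈ X ↔ (J = {a, b} ∧ IsLong ℓp {a, b}) ∨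
      (J = {b, c} ∧ IsLong ℓp {b, c} ∧ IsLong ℓm {b, d}) ∨
      J ∈ T.image fun i => ({i, c} : Finset (Fin n)) := by
    intro J
    simp only [hX, hT, mem_filter, mem_univ, true_and, mem_image]
    constructor
    · rintro ⟨h1, h2, h3⟩
      obtain ⟨i, j, hij, hJ⟩ : ∃ i j, i < j ∧ J = {i, j} := by
        obtain ⟨x, y, hxy, hJ⟩ := Finset.card_eq_two.1 (show J.card = 2 by omega)
        rcases lt_or_gt_of_ne hxy with h | h
        · exact ⟨x, y, h, hJ⟩
        · exact ⟨y, x, h, by rw [hJ, Finset.pair_comm]⟩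
      subst hJ
      have hj := h1 j (by simp)
      have hij' : (i : ℕ) < j := hij
      by_cases hjc : j = c
      · subst hjc
        rcases lt_or_gt_of_ne (hgenm {i, d}) with h4 | h4
        · exact Or.inr (Or.inr ⟨i, ⟨by omega, h4, h3⟩, rfl⟩)
        · have hib := eq_of_isLong_of_isLong hpp hpos heq hmono hb hc hd hlt (by omega) h3 h4
          subst hib
          exact Or.inr (Or.inl ⟨rfl, h3, h4⟩)
      · obtain ⟨rfl, rfl⟩ := h3.eq_of_lt hpp hmonop ha hb hc hij (by omega)
        exact Or.inl ⟨rfl, h3⟩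
    · have key : ∀ i j : Fin n, i < j → (j : ℕ) + 1 < n → IsLong ℓp {i, j} →
          (∀ k ∈ ({i, j} : Finset (Fin n)), (k : ℕ) + 1 < n) ∧
          ((({i, j} : Finset (Fin n)).card : ℕ) : ℤ) = (n : ℤ) - (n - 3) - 1 ∧
          IsLong ℓp {i, j} := by
        intro i j hij hj h
        have hij' : (i : ℕ) < j := hij
        refine ⟨?_, ?_, h⟩
        · intro k hk
          simp only [mem_insert, mem_singleton] at hk
          omega
        · rw [Finset.card_pair hij.ne]
          push_cast
          ring
      rintro (⟨rfl, h⟩ | ⟨rfl, h, -⟩ | ⟨i, ⟨hi, -, h⟩, rfl⟩)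
      · exact key a b (by omega) (by omega) h
      · exact key b c (by omega) (by omega) h
      · exact key i c (by omega) (by omega) h
  rw [hBcard, ← hTc]
  by_cases hA : IsLong ℓp {a, b}
  · have hB' := not_isLong_of_isLong hpp hpos heq hmono ha hb hc hd hlt hA
    rw [if_pos (Or.inl hA), ← Finset.card_insert_of_notMem (a := {a, b})]
    · congr 1
      ext J
      rw [hXmem, mem_insert]
      tauto
    · simp only [mem_image, not_exists, not_and]
      intro i _ h
      have : c ∈ ({a, b} : Finset (Fin n)) := by
        rw [← h]
        simp
      simp only [mem_insert, mem_singleton] at this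
      omega
  by_cases hB' : IsLong ℓp {b, c} ∧ IsLong ℓm {b, d}
  · rw [if_pos (Or.inr hB'), ← Finset.card_insert_of_notMem (a := {b, c})]
    · congr 1
      ext J
      rw [hXmem, mem_insert]
      tauto
    · simp only [mem_image, not_exists, not_and]
      intro i hi h
      simp only [hT, mem_filter, mem_univ, true_and] at hi
      have hb' : b ∈ ({i, c} : Finset (Fin n)) := by
        rw [h]
        simp
      simp only [mem_insert, mem_singleton] at hb'
      obtain rfl : b = i := by omega
      exact lt_asymm hB'.2 hi.2.1
  · rw [if_neg (by tauto), add_zero]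
    congr 1
    ext J
    rw [hXmem]
    tauto

/-- The difference `α_{n−3}(ℓ⁺) − β_{n−3}(ℓ⁻, ℓ⁺)` is either `0` or `1`; it equals `1`
iff either (a) `2(ℓ_{n−3} + ℓ_{n−2}) ≥ ℓ_1 + … + ℓ_{n−1} + ℓ_n⁺`, or (b) both
`2(ℓ_{n−2} + ℓ_{n−1}) ≥ ℓ_1 + … + ℓ_{n−1} + ℓ_n⁺` and
`2(ℓ_{n−2} + ℓ_n⁻) ≥ ℓ_1 + … + ℓ_{n−1} + ℓ_n⁻`; moreover (a) and (b) cannot hold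
simultaneously. -/
theorem stmt_10 (n : ℕ) (hn : 4 ≤ n) (ℓp ℓm : Fin n → ℝ)
    (hpos : ∀ i : Fin n, 0 < ℓm i)
    (heq : ∀ i : Fin n, (i : ℕ) + 1 < n → ℓp i = ℓm i)
    (hmono : ∀ i j : Fin n, i ≤ j → (j : ℕ) + 1 < n → ℓm i ≤ ℓm j)
    (hlt : ℓm ⟨n - 1, by omega⟩ < ℓp ⟨n - 1, by omega⟩)
    (hgenp : Generic ℓp) (hgenm : Generic ℓm) :
    ((alphaNum ℓp ((n : ℤ) - 3) : ℤ) - (betaNum ℓm ℓp ((n : ℤ) - 3) : ℤ) = 0 ∨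
      (alphaNum ℓp ((n : ℤ) - 3) : ℤ) - (betaNum ℓm ℓp ((n : ℤ) - 3) : ℤ) = 1) ∧
    ((alphaNum ℓp ((n : ℤ) - 3) : ℤ) - (betaNum ℓm ℓp ((n : ℤ) - 3) : ℤ) = 1 ↔
      (2 * (ℓm ⟨n - 4, by omega⟩ + ℓm ⟨n - 3, by omega⟩) ≥
          (∑ i ∈ univ.filter (fun i : Fin n => (i : ℕ) + 1 < n), ℓm i) +
            ℓp ⟨n - 1, by omega⟩ ∨
        (2 * (ℓm ⟨n - 3, by omega⟩ + ℓm ⟨n - 2, by omega⟩) ≥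
            (∑ i ∈ univ.filter (fun i : Fin n => (i : ℕ) + 1 < n), ℓm i) +
              ℓp ⟨n - 1, by omega⟩ ∧
          2 * (ℓm ⟨n - 3, by omega⟩ + ℓm ⟨n - 1, by omega⟩) ≥
            (∑ i ∈ univ.filter (fun i : Fin n => (i : ℕ) + 1 < n), ℓm i) +
              ℓm ⟨n - 1, by omega⟩))) ∧
    ¬(2 * (ℓm ⟨n - 4, by omega⟩ + ℓm ⟨n - 3, by omega⟩) ≥
          (∑ i ∈ univ.filter (fun i : Fin n => (i : ℕ) + 1 < n), ℓm i) +
            ℓp ⟨n - 1, by omega⟩ ∧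
        (2 * (ℓm ⟨n - 3, by omega⟩ + ℓm ⟨n - 2, by omega⟩) ≥
            (∑ i ∈ univ.filter (fun i : Fin n => (i : ℕ) + 1 < n), ℓm i) +
              ℓp ⟨n - 1, by omega⟩ ∧
          2 * (ℓm ⟨n - 3, by omega⟩ + ℓm ⟨n - 1, by omega⟩) ≥
            (∑ i ∈ univ.filter (fun i : Fin n => (i : ℕ) + 1 < n), ℓm i) +
              ℓm ⟨n - 1, by omega⟩)) := by
  have hpp : ∀ i, 0 < ℓp i := by
    intro i
    by_cases hi : (i : ℕ) + 1 < n
    · rw [heq i hi]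
      exact hpos i
    · have hi' : i = ⟨n - 1, by omega⟩ := Fin.ext (by simp only; omega)
      rw [hi']
      exact (hpos _).trans hlt
  obtain ⟨a, haa⟩ : ∃ a : Fin n, a = ⟨n - 4, by omega⟩ := ⟨_, rfl⟩
  obtain ⟨b, hbb⟩ : ∃ b : Fin n, b = ⟨n - 3, by omega⟩ := ⟨_, rfl⟩
  obtain ⟨c, hcc⟩ : ∃ c : Fin n, c = ⟨n - 2, by omega⟩ := ⟨_, rfl⟩
  obtain ⟨d, hdd⟩ : ∃ d : Fin n, d = ⟨n - 1, by omega⟩ := ⟨_, rfl⟩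
  rw [← hdd] at hlt
  rw [← haa, ← hbb, ← hcc, ← hdd]
  have ha : (a : ℕ) + 4 = n := by rw [haa]; simp only; omega
  have hb : (b : ℕ) + 3 = n := by rw [hbb]; simp only; omega
  have hc : (c : ℕ) + 2 = n := by rw [hcc]; simp only; omega
  have hd : (d : ℕ) + 1 = n := by rw [hdd]; simp only; omega
  rw [sum_filter_add_last heq hd, sum_filter_add_last (ℓp := ℓm) (fun _ _ => rfl) hd,
    ← heq a (by omega), ← hgenm.isLong_pair_iff (show b ≠ d by omega),
    ← heq b (by omega), ← heq c (by omega), ← hgenp.isLong_pair_iff (show a ≠ b by omega),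
    ← hgenp.isLong_pair_iff (show b ≠ c by omega),
    alphaNum_eq_card_add hpp hpos heq hmono ha hb hc hd hlt hgenm]
  have hex : IsLong ℓp {a, b} → ¬ IsLong ℓm {b, d} :=
    not_isLong_of_isLong hpp hpos heq hmono ha hb hc hd hlt
  refine ⟨?_, ?_, fun h => hex h.1 h.2.2⟩
  · split_ifs <;> simp
  · split_ifs with h <;> simp [h]
end

section
/- Let n ≥ 3 and 0 < a < b, and let ℓ⁻ = (1,…,1,a) and ℓ⁺ = (1,…,1,b) in ℝⁿ (equilateral linkage with telescopic leg varying in [a,b]). Then for every k with 0 ≤ k ≤ n−2: if n ≠ 2k+2 then β_k(ℓ⁺, ℓ⁻) = 0; and if n = 2k+2, then β_k(ℓ⁺, ℓ⁻) = C(n−2, k) (the binomial coefficient) when b < 1, and β_k(ℓ⁺, ℓ⁻) = 0 when b > 1. -/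
open Finset
open scoped Classical

/-- A sum of equilateral leg lengths over a set avoiding the last leg is its cardinality. -/
theorem sum_equilateral_of_avoids_last {n : ℕ} (c : ℝ) {J : Finset (Fin n)}
    (hJ : ∀ i ∈ J, (i : ℕ) + 1 < n) :
    ∑ i ∈ J, (if (i : ℕ) + 1 = n then c else 1) = (J.card : ℝ) := by
  rw [Finset.sum_congr rfl fun i hi => if_neg (hJ i hi).ne]
  simp

/-- The total length of the equilateral linkage with last leg `c`. -/
theorem sum_univ_equilateral {n : ℕ} (hn : 1 ≤ n) (c : ℝ) :
    ∑ i : Fin n, (if (i : ℕ) + 1 = n then c else 1) = (n : ℝ) - 1 + c := by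
  obtain ⟨m, rfl⟩ : ∃ m, n = m + 1 := ⟨n - 1, by lia⟩
  rw [Fin.sum_univ_castSucc]
  have h : ∀ i : Fin m, (i : ℕ) ≠ m := fun i => i.isLt.ne
  simp [h]

/-- The signed sum of `J ∪ {n}` for the equilateral linkage with last leg `c`. -/
theorem dsum_equilateral_union_last {n : ℕ} (hn : 1 ≤ n) (c : ℝ) {J : Finset (Fin n)}
    (hJ : ∀ i ∈ J, (i : ℕ) + 1 < n) :
    dsum (fun i : Fin n => if (i : ℕ) + 1 = n then c else 1)
      (J ∪ univ.filter (fun i : Fin n => (i : ℕ) + 1 = n)) = 2 * J.card + 1 + c - n := by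
  have hlast : univ.filter (fun i : Fin n => (i : ℕ) + 1 = n) = {⟨n - 1, by lia⟩} := by
    ext i
    simp only [mem_filter, mem_univ, true_and, mem_singleton, Fin.ext_iff]
    lia
  have hdisj : Disjoint J {(⟨n - 1, by lia⟩ : Fin n)} := by
    rw [Finset.disjoint_singleton_right]
    intro h
    have := hJ _ h
    simp only at this
    lia
  rw [dsum_eq_two_mul_sub, hlast, Finset.sum_union hdisj, sum_equilateral_of_avoids_last c hJ,
    sum_univ_equilateral hn, Finset.sum_singleton, if_pos (by simp only; lia)]
  ring

/-- The signed sum of `J ∪ {n - 1}` for the equilateral linkage with last leg `c`. -/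
theorem dsum_equilateral_union_penultimate {n : ℕ} (hn : 2 ≤ n) (c : ℝ) {J : Finset (Fin n)}
    (hJ : ∀ i ∈ J, (i : ℕ) + 2 < n) :
    dsum (fun i : Fin n => if (i : ℕ) + 1 = n then c else 1)
      (J ∪ univ.filter (fun i : Fin n => (i : ℕ) + 2 = n)) = 2 * J.card + 3 - c - n := by
  have hpen : univ.filter (fun i : Fin n => (i : ℕ) + 2 = n) = {⟨n - 2, by lia⟩} := by
    ext i
    simp only [mem_filter, mem_univ, true_and, mem_singleton, Fin.ext_iff]
    lia
  have hdisj : Disjoint J {(⟨n - 2, by lia⟩ : Fin n)} := by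
    rw [Finset.disjoint_singleton_right]
    intro h
    have := hJ _ h
    simp only at this
    lia
  rw [dsum_eq_two_mul_sub, hpen, Finset.sum_union hdisj,
    sum_equilateral_of_avoids_last c fun i hi => by have := hJ i hi; lia,
    sum_univ_equilateral (by lia), Finset.sum_singleton, if_neg (by simp only; lia)]
  ring

/-- The subsets of the first `n - 2` legs having `m` elements number `(n - 2).choose m`. -/
theorem card_filter_avoids_last_two {n : ℕ} (m : ℕ) :
    (univ.filter (fun J : Finset (Fin n) => (∀ i ∈ J, (i : ℕ) + 2 < n) ∧ J.card = m)).card =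
      (n - 2).choose m := by
  have hcard : (univ.filter (fun i : Fin n => (i : ℕ) < n - 2)).card = n - 2 := by
    rw [Fin.card_filter_val_lt]
    lia
  rw [← hcard, ← Finset.card_powersetCard]
  congr 1
  ext J
  simp only [mem_filter, mem_univ, true_and, mem_powersetCard, Finset.subset_iff,
    Nat.lt_sub_iff_add_lt]

/-- Counting `betaNum` for the equilateral linkage in terms of cardinalities only. -/
theorem betaNum_equilateral {n : ℕ} (hn : 2 ≤ n) (a b : ℝ) (k : ℤ) :
    betaNum (fun i : Fin n => if (i : ℕ) + 1 = n then b else 1)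
        (fun i : Fin n => if (i : ℕ) + 1 = n then a else 1) k =
      (univ.filter (fun J : Finset (Fin n) =>
        (∀ i ∈ J, (i : ℕ) + 2 < n) ∧ (J.card : ℤ) = (n : ℤ) - k - 2 ∧
          (2 * (J.card : ℝ) + 1 + b - n < 0 ∧ 0 < 2 * (J.card : ℝ) + 3 - a - n))).card := by
  unfold betaNum IsShort IsLong
  congr 1
  ext J
  simp only [mem_filter, mem_univ, true_and]
  refine and_congr_right fun hJ => ?_
  rw [dsum_equilateral_union_last (by lia) b fun i hi => by have := hJ i hi; lia,
    dsum_equilateral_union_penultimate hn a hJ]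

/-- For the equilateral linkage with telescopic leg varying in `[a, b]`
(`ℓ⁻ = (1,…,1,a)`, `ℓ⁺ = (1,…,1,b)`): if `n ≠ 2k + 2` then `β_k(ℓ⁺, ℓ⁻) = 0`;
if `n = 2k + 2` then `β_k(ℓ⁺, ℓ⁻) = C(n−2, k)` when `b < 1` and `β_k(ℓ⁺, ℓ⁻) = 0`
when `b > 1`. -/
theorem stmt_18 (n : ℕ) (hn : 3 ≤ n) (a b : ℝ) (ha : 0 < a) (hab : a < b)
    (ℓm ℓp : Fin n → ℝ)
    (hℓm : ℓm = fun i : Fin n => if (i : ℕ) + 1 = n then a else 1)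
    (hℓp : ℓp = fun i : Fin n => if (i : ℕ) + 1 = n then b else 1)
    (k : ℕ) (hk : k ≤ n - 2) :
    (n ≠ 2 * k + 2 → betaNum ℓp ℓm (k : ℤ) = 0) ∧
    (n = 2 * k + 2 →
      (b < 1 → betaNum ℓp ℓm (k : ℤ) = (n - 2).choose k) ∧
      (1 < b → betaNum ℓp ℓm (k : ℤ) = 0)) := by
  subst hℓm hℓp
  rw [betaNum_equilateral (by lia)]
  refine ⟨fun hnk => ?_, fun hnk => ⟨fun hb => ?_, fun hb => ?_⟩⟩
  · rw [Finset.card_eq_zero, Finset.filter_eq_empty_iff]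
    rintro J - ⟨-, hcard, hshort, hlong⟩
    have hlt : 2 * J.card + 1 < n := by
      have : (2 * J.card + 1 : ℝ) < n := by linarith
      exact_mod_cast this
    have hgt : n < 2 * J.card + 3 := by
      have : (n : ℝ) < 2 * J.card + 3 := by linarith
      exact_mod_cast this
    lia
  · subst hnk
    rw [← card_filter_avoids_last_two]
    congr 1
    ext J
    simp only [mem_filter, mem_univ, true_and]
    refine and_congr_right fun _ => ⟨fun h => by lia, fun h => ⟨by lia, ?_⟩⟩
    rw [h]
    push_cast
    constructor <;> linarith
  · rw [Finset.card_eq_zero, Finset.filter_eq_empty_iff]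
    rintro J - ⟨-, hcard, hshort, -⟩
    have hJ : J.card = k := by lia
    rw [hJ, hnk] at hshort
    push_cast at hshort
    linarith
end
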